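/- Graded Smith normal form: let k be a field, let e : Fin m → ℕ and d : Fin n → ℕ be degree vectors, and let A be an m × n matrix over k[t] that is graded with respect to (e, d), meaning: for all i, j, if e i ≤ d j then A i j = c · t^{d j − e i} for some c ∈ k, and if e i > d j then A i j = 0. Then there exist an invertible m × m matrix S over k[t] that is graded with respect to (e, e) (i.e., S i j = c · t^{e j − e i} for some c ∈ k when e i ≤ e j, and S i j = 0 otherwise) and an invertible n × n matrix T over k[t] that is graded with respect to (d, d), such that the matrix S·A·T has at most one nonzero entry in each row and at most one nonzero entry in each column. -/

import Mathlib

open Polynomial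

/-- A matrix `A` over `k[t]` is graded with respect to degree vectors `e` (for
rows) and `d` (for columns) if `A i j` is a scalar multiple of `t^(d j - e i)`
whenever `e i ≤ d j`, and `A i j = 0` whenever `e i > d j`. -/
def MatrixGraded {k : Type*} [Field k] {m n : ℕ}
    (e : Fin m → ℕ) (d : Fin n → ℕ) (A : Matrix (Fin m) (Fin n) k[X]) : Prop :=
  ∀ i j, (e i ≤ d j → ∃ c : k, A i j = C c * X ^ (d j - e i)) ∧
    (d j < e i → A i j = 0)

/-- Uniform version of the entrywise grading condition. -/
def GradedEntry {k : Type*} [Field k] (a b : ℕ) (p : k[X]) : Prop :=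
  ∃ c : k, p * X ^ a = C c * X ^ b

theorem gradedEntry_iff {k : Type*} [Field k] (a b : ℕ) (p : k[X]) :
    ((a ≤ b → ∃ c : k, p = C c * X ^ (b - a)) ∧ (b < a → p = 0)) ↔ GradedEntry a b p := by
  constructor
  · rintro ⟨h1, h2⟩
    rcases le_or_gt a b with h | h
    · obtain ⟨c, rfl⟩ := h1 h
      exact ⟨c, by rw [mul_assoc, ← pow_add, Nat.sub_add_cancel h]⟩
    · exact ⟨0, by simp [h2 h]⟩
  · rintro ⟨c, hc⟩
    constructor
    · intro h
      refine ⟨c, ?_⟩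
      apply mul_right_cancel₀ (pow_ne_zero a (X_ne_zero (R := k)))
      rw [hc, mul_assoc, ← pow_add, Nat.sub_add_cancel h]
    · intro h
      have h0 : c = 0 := by
        have := congrArg (fun q => coeff q b) hc
        simp only [coeff_mul_X_pow'] at this
        rw [if_neg (by omega)] at this
        simpa using this.symm
      rw [h0, C_0, zero_mul] at hc
      exact (mul_eq_zero.mp hc).resolve_right (pow_ne_zero a X_ne_zero)

theorem matrixGraded_iff {k : Type*} [Field k] {m n : ℕ}
    (e : Fin m → ℕ) (d : Fin n → ℕ) (A : Matrix (Fin m) (Fin n) k[X]) :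
    MatrixGraded e d A ↔ ∀ i j, GradedEntry (e i) (d j) (A i j) :=
  forall_congr' fun _ => forall_congr' fun _ => gradedEntry_iff _ _ _

theorem GradedEntry.zero {k : Type*} [Field k] (a b : ℕ) : GradedEntry a b (0 : k[X]) :=
  ⟨0, by simp⟩

theorem GradedEntry.one {k : Type*} [Field k] (a : ℕ) : GradedEntry a a (1 : k[X]) :=
  ⟨1, by simp⟩

theorem GradedEntry.add {k : Type*} [Field k] {a b : ℕ} {p q : k[X]}
    (hp : GradedEntry a b p) (hq : GradedEntry a b q) : GradedEntry a b (p + q) := by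
  obtain ⟨c, hc⟩ := hp
  obtain ⟨c', hc'⟩ := hq
  exact ⟨c + c', by rw [add_mul, hc, hc', C_add, add_mul]⟩

theorem GradedEntry.sub {k : Type*} [Field k] {a b : ℕ} {p q : k[X]}
    (hp : GradedEntry a b p) (hq : GradedEntry a b q) : GradedEntry a b (p - q) := by
  obtain ⟨c, hc⟩ := hp
  obtain ⟨c', hc'⟩ := hq
  exact ⟨c - c', by rw [sub_mul, hc, hc', C_sub, sub_mul]⟩

theorem GradedEntry.mul {k : Type*} [Field k] {a b c : ℕ} {p q : k[X]}
    (hp : GradedEntry a b p) (hq : GradedEntry b c q) : GradedEntry a c (p * q) := by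
  obtain ⟨x, hx⟩ := hp
  obtain ⟨y, hy⟩ := hq
  refine ⟨x * y, ?_⟩
  rw [C_mul]
  linear_combination q * hx + C x * hy

theorem MatrixGraded.mul {k : Type*} [Field k] {l m n : ℕ}
    {e : Fin l → ℕ} {f : Fin m → ℕ} {g : Fin n → ℕ}
    {A : Matrix (Fin l) (Fin m) k[X]} {B : Matrix (Fin m) (Fin n) k[X]}
    (hA : MatrixGraded e f A) (hB : MatrixGraded f g B) : MatrixGraded e g (A * B) := by
  rw [matrixGraded_iff] at *
  intro i j
  rw [Matrix.mul_apply]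
  refine Finset.sum_induction _ (GradedEntry (e i) (g j)) (fun _ _ => GradedEntry.add)
    (GradedEntry.zero _ _) (fun x _ => (hA i x).mul (hB x j))

theorem MatrixGraded.one {k : Type*} [Field k] {m : ℕ} (e : Fin m → ℕ) :
    MatrixGraded e e (1 : Matrix (Fin m) (Fin m) k[X]) := by
  rw [matrixGraded_iff]
  intro i j
  rcases eq_or_ne i j with rfl | h
  · simpa using GradedEntry.one (k := k) (e i)
  · simpa [Matrix.one_apply_ne h] using GradedEntry.zero (k := k) (e i) (e j)

/-- Quotient of two entries in the same column. -/
theorem GradedEntry.div_col {k : Type*} [Field k] {a a' b : ℕ} {p q : k[X]}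
    (hp : GradedEntry a b p) (hq : GradedEntry a' b q) (hq0 : q ≠ 0) (h : p ≠ 0 → a ≤ a') :
    ∃ u : k[X], GradedEntry a a' u ∧ p = u * q := by
  by_cases hp0 : p = 0
  · exact ⟨0, GradedEntry.zero _ _, by simp [hp0]⟩
  obtain ⟨c, hc⟩ := hp
  obtain ⟨c', hc'⟩ := hq
  have hc0 : c' ≠ 0 := by
    rintro rfl
    rw [C_0, zero_mul] at hc'
    exact (mul_ne_zero hq0 (pow_ne_zero _ X_ne_zero)) hc'
  have hu : C (c / c') * X ^ (a' - a) * X ^ a = C (c / c') * X ^ a' := by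
    rw [mul_assoc, ← pow_add, Nat.sub_add_cancel (h hp0)]
  refine ⟨C (c / c') * X ^ (a' - a), ⟨c / c', hu⟩, ?_⟩
  apply mul_right_cancel₀ (pow_ne_zero a (X_ne_zero (R := k)))
  have h3 : C (c / c') * C c' = C c := by rw [← C_mul, div_mul_cancel₀ _ hc0]
  linear_combination hc - q * hu - C (c / c') * hc' - X ^ b * h3

/-- Quotient of two entries in the same row. -/
theorem GradedEntry.div_row {k : Type*} [Field k] {a b b' : ℕ} {p q : k[X]}
    (hp : GradedEntry a b p) (hq : GradedEntry a b' q) (hq0 : q ≠ 0) (h : p ≠ 0 → b' ≤ b) :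
    ∃ u : k[X], GradedEntry b' b u ∧ p = q * u := by
  by_cases hp0 : p = 0
  · exact ⟨0, GradedEntry.zero _ _, by simp [hp0]⟩
  obtain ⟨c, hc⟩ := hp
  obtain ⟨c', hc'⟩ := hq
  have hc0 : c' ≠ 0 := by
    rintro rfl
    rw [C_0, zero_mul] at hc'
    exact (mul_ne_zero hq0 (pow_ne_zero _ X_ne_zero)) hc'
  have hu : C (c / c') * X ^ (b - b') * X ^ b' = C (c / c') * X ^ b := by
    rw [mul_assoc, ← pow_add, Nat.sub_add_cancel (h hp0)]
  refine ⟨C (c / c') * X ^ (b - b'), ⟨c / c', hu⟩, ?_⟩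
  apply mul_right_cancel₀ (pow_ne_zero a (X_ne_zero (R := k)))
  have h3 : C (c / c') * C c' = C c := by rw [← C_mul, div_mul_cancel₀ _ hc0]
  linear_combination hc - C (c / c') * X ^ (b - b') * hc' - C c' * hu - X ^ b * h3

theorem isUnit_one_sub_of_sq {R : Type*} [Ring R] (U : R) (h : U * U = 0) : IsUnit (1 - U) :=
  IsNilpotent.isUnit_one_sub ⟨2, by rw [pow_two, h]⟩

/-- One elimination step at a pivot. -/
theorem pivot_step {k : Type*} [Field k] {m n : ℕ}
    (e : Fin m → ℕ) (d : Fin n → ℕ) (A : Matrix (Fin m) (Fin n) k[X])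
    (hA : MatrixGraded e d A) (i0 : Fin m) (j0 : Fin n) (h0 : A i0 j0 ≠ 0)
    (hi : ∀ i, A i j0 ≠ 0 → e i ≤ e i0) (hj : ∀ j, A i0 j ≠ 0 → d j0 ≤ d j) :
    ∃ (S : Matrix (Fin m) (Fin m) k[X]) (T : Matrix (Fin n) (Fin n) k[X]),
      IsUnit S ∧ IsUnit T ∧ MatrixGraded e e S ∧ MatrixGraded d d T ∧
      (∀ j, j ≠ j0 → (S * A * T) i0 j = 0) ∧
      (∀ i, i ≠ i0 → (S * A * T) i j0 = 0) ∧
      (∀ i j, i ≠ i0 → (A i j0 = 0 ∨ A i0 j = 0) → (S * A * T) i j = A i j) := by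
  have hG := (matrixGraded_iff e d A).1 hA
  choose u hu hu' using fun i => (hG i j0).div_col (hG i0 j0) h0 (hi i)
  choose v hv hv' using fun j => (hG i0 j).div_row (hG i0 j0) h0 (hj j)
  let U : Matrix (Fin m) (Fin m) k[X] :=
    Matrix.of fun i i' => if i' = i0 then (if i = i0 then 0 else u i) else 0
  let V : Matrix (Fin n) (Fin n) k[X] :=
    Matrix.of fun j' j => if j' = j0 then (if j = j0 then 0 else v j) else 0
  have hUA : ∀ (l : ℕ) (B : Matrix (Fin m) (Fin l) k[X]) i j,
      (U * B) i j = (if i = i0 then 0 else u i) * B i0 j := by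
    intro l B i j
    simp only [U, Matrix.mul_apply, Matrix.of_apply, ite_mul _ _ _ (B _ _), zero_mul]
    simp
  have hAV : ∀ (l : ℕ) (B : Matrix (Fin l) (Fin n) k[X]) i j,
      (B * V) i j = B i j0 * (if j = j0 then 0 else v j) := by
    intro l B i j
    simp only [V, Matrix.mul_apply, Matrix.of_apply]
    rw [Finset.sum_eq_single j0]
    · simp
    · intro b _ hb
      simp [hb]
    · simp
  have hB : ∀ i j, ((1 - U) * A * (1 - V) : Matrix (Fin m) (Fin n) k[X]) i j =
      (A i j - (if i = i0 then 0 else u i) * A i0 j) -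
      (A i j0 - (if i = i0 then 0 else u i) * A i0 j0) * (if j = j0 then 0 else v j) := by
    intro i j
    rw [Matrix.mul_sub, Matrix.mul_one, Matrix.sub_apply, hAV, Matrix.sub_mul, Matrix.one_mul, Matrix.sub_apply,
      Matrix.sub_apply, hUA, hUA]
  refine ⟨1 - U, 1 - V, isUnit_one_sub_of_sq _ ?_, isUnit_one_sub_of_sq _ ?_, ?_, ?_, ?_, ?_, ?_⟩
  · ext1 i j
    rw [hUA]
    simp [U]
  · ext1 i j
    rw [hAV]
    simp [V]
  · have h1 := (matrixGraded_iff e e _).1 (MatrixGraded.one (k := k) e)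
    rw [matrixGraded_iff]
    intro i j
    refine (h1 i j).sub ?_
    simp only [U, Matrix.of_apply]
    split_ifs with h h'
    · exact GradedEntry.zero _ _
    · rw [h]; exact hu i
    · exact GradedEntry.zero _ _
  · have h1 := (matrixGraded_iff d d _).1 (MatrixGraded.one (k := k) d)
    rw [matrixGraded_iff]
    intro i j
    refine (h1 i j).sub ?_
    simp only [V, Matrix.of_apply]
    split_ifs with h h'
    · exact GradedEntry.zero _ _
    · rw [h]; exact hv j
    · exact GradedEntry.zero _ _
  · intro j hj
    rw [hB, if_pos rfl, if_neg hj]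
    linear_combination hv' j
  · intro i hi
    rw [hB, if_neg hi, if_pos rfl]
    linear_combination hu' i
  · intro i j hi h
    rw [hB, if_neg hi, ← hu' i]
    rcases h with h | h
    · have : u i = 0 := by
        have := hu' i
        rw [h] at this
        exact (mul_eq_zero.mp this.symm).resolve_right h0
      rw [this]; ring
    · rw [h]; ring

/-- The induction: rows outside `R` are already in normal form. -/
theorem smith_induction {k : Type*} [Field k] {m n : ℕ}
    (e : Fin m → ℕ) (d : Fin n → ℕ) (N : ℕ) : ∀ (R : Finset (Fin m)), R.card = N →
    ∀ (A : Matrix (Fin m) (Fin n) k[X]), MatrixGraded e d A →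
    (∀ i j, i ∉ R → A i j ≠ 0 →
      (∀ j', A i j' ≠ 0 → j' = j) ∧ (∀ i', A i' j ≠ 0 → i' = i)) →
    ∃ (S : Matrix (Fin m) (Fin m) k[X]) (T : Matrix (Fin n) (Fin n) k[X]),
      IsUnit S ∧ IsUnit T ∧
      MatrixGraded e e S ∧ MatrixGraded d d T ∧
      (∀ i j, (S * A * T) i j ≠ 0 →
        (∀ j', (S * A * T) i j' ≠ 0 → j' = j) ∧ (∀ i', (S * A * T) i' j ≠ 0 → i' = i)) := by
  induction N with
  | zero =>
    intro R hR A hA hinv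
    refine ⟨1, 1, isUnit_one, isUnit_one, MatrixGraded.one e, MatrixGraded.one d, ?_⟩
    rw [Finset.card_eq_zero] at hR
    subst hR
    simpa using hinv
  | succ N ih =>
    intro R hR A hA hinv
    obtain ⟨i0, hi0, hmax⟩ := R.exists_max_image e (Finset.card_pos.1 (by omega))
    have hcard : (R.erase i0).card = N := by
      rw [Finset.card_erase_of_mem hi0, hR]; rfl
    by_cases hz : ∀ j, A i0 j = 0
    · refine ih (R.erase i0) hcard A hA ?_
      intro i j hi hij
      refine hinv i j (fun hiR => ?_) hij
      have : i = i0 := by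
        by_contra hne
        exact hi (Finset.mem_erase.2 ⟨hne, hiR⟩)
      subst this
      exact hij (hz j)
    · push Not at hz
      obtain ⟨j1, hj1⟩ := hz
      classical
      obtain ⟨j0, hj0, hmin⟩ := (Finset.univ.filter fun j => A i0 j ≠ 0).exists_min_image d
        ⟨j1, by simp [hj1]⟩
      have h0 : A i0 j0 ≠ 0 := by simpa using hj0
      have hcol : ∀ i, i ∉ R → A i j0 = 0 := by
        intro i hi
        by_contra hne
        have := (hinv i j0 hi hne).2 i0 h0
        exact hi (this ▸ hi0)
      obtain ⟨S, T, hS, hT, hSg, hTg, hrow, hcl, hsame⟩ := pivot_step e d A hA i0 j0 h0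
        (fun i hi => hmax i (by by_contra hR; exact hi (hcol i hR)))
        (fun j hj => hmin j (by simpa using hj))
      obtain ⟨S', T', hS', hT', hSg', hTg', hfin⟩ := ih (R.erase i0) hcard (S * A * T)
        ((hSg.mul hA).mul hTg) (by
          intro i j hi hij
          by_cases hii : i = i0
          · subst hii
            have hjj : j = j0 := by
              by_contra hne
              exact hij (hrow j hne)
            subst hjj
            refine ⟨fun j' hj' => ?_, fun i' hi' => ?_⟩
            · by_contra hne
              exact hj' (hrow j' hne)
            · by_contra hne
              exact hi' (hcl i' hne)
          · have hiR : i ∉ R := fun h => hi (Finset.mem_erase.2 ⟨hii, h⟩)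
            have hs : ∀ j', (S * A * T) i j' = A i j' :=
              fun j' => hsame i j' hii (Or.inl (hcol i hiR))
            rw [hs] at hij
            obtain ⟨q1, q2⟩ := hinv i j hiR hij
            have hz0 : A i0 j = 0 := by
              by_contra hne
              exact hii (q2 i0 hne).symm
            have hjj : j ≠ j0 := by
              rintro rfl
              exact h0 hz0
            refine ⟨fun j' hj' => q1 j' (by rwa [hs] at hj'), fun i' hi' => ?_⟩
            by_cases hi'0 : i' = i0
            · subst hi'0
              exact absurd (hrow j hjj) hi'
            · rw [hsame i' j hi'0 (Or.inr hz0)] at hi'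
              exact q2 i' hi')
      refine ⟨S' * S, T * T', hS'.mul hS, hT.mul hT', hSg'.mul hSg, hTg.mul hTg', ?_⟩
      have : S' * S * A * (T * T') = S' * (S * A * T) * T' := by
        simp only [Matrix.mul_assoc]
      rw [this]
      exact hfin

/-- Graded Smith normal form: any matrix `A` over `k[t]` that is graded with
respect to degree vectors `(e, d)` can be brought, by multiplication with
invertible graded matrices `S` (graded w.r.t. `(e, e)`) and `T` (graded
w.r.t. `(d, d)`), to a form `S·A·T` with at most one nonzero entry in each row
and in each column. -/
theorem graded_smith_normal_form {k : Type*} [Field k] {m n : ℕ}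
    (e : Fin m → ℕ) (d : Fin n → ℕ) (A : Matrix (Fin m) (Fin n) k[X])
    (hA : MatrixGraded e d A) :
    ∃ (S : Matrix (Fin m) (Fin m) k[X]) (T : Matrix (Fin n) (Fin n) k[X]),
      IsUnit S ∧ IsUnit T ∧
      MatrixGraded e e S ∧ MatrixGraded d d T ∧
      (∀ i j₁ j₂, (S * A * T) i j₁ ≠ 0 → (S * A * T) i j₂ ≠ 0 → j₁ = j₂) ∧
      (∀ i₁ i₂ j, (S * A * T) i₁ j ≠ 0 → (S * A * T) i₂ j ≠ 0 → i₁ = i₂) := by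
  obtain ⟨S, T, hS, hT, hSg, hTg, h⟩ := smith_induction e d _ Finset.univ rfl A hA
    (fun i _ hi => absurd (Finset.mem_univ i) hi)
  exact ⟨S, T, hS, hT, hSg, hTg, fun i j₁ j₂ h1 h2 => (h i j₂ h2).1 j₁ h1,
    fun i₁ i₂ j h1 h2 => (h i₂ j h2).2 i₁ h1⟩
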